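/- arXiv:1911.12625 — 8 statements merged into one kernel-verified Lean document; each statement's English description precedes it below -/
import Mathlib

section
/- Let R and S be sets. On the set 𝒫(R,S) of partial functions from R to S with the operations f ∧ g = (restriction of f to dom f ∩ dom g) and f ∨ g = (the partial function with domain dom f ∪ dom g equal to g on dom g and to f on dom f ∖ dom g), both operations are idempotent and associative, the absorption laws x∧(x∨y) = x = x∨(x∧y) and (x∧y)∨y = y = (x∨y)∧y hold, the left-handed identities f∧g∧f = f∧g and f∨g∨f = g∨f hold, and the empty partial function 0 satisfies f∨0 = f = 0∨f and f∧0 = 0 = 0∧f. -/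
/-- The restriction operation on partial functions:
`f ∧ g` is the restriction of `f` to `dom f ∩ dom g`. -/
def pmeet {R S : Type*} (f g : R →. S) : R →. S :=
  fun x => ⟨(f x).Dom ∧ (g x).Dom, fun h => (f x).get h.1⟩

open Classical in
/-- The override operation on partial functions: `f ∨ g` has domain `dom f ∪ dom g`,
equals `g` on `dom g` and equals `f` on `dom f ∖ dom g`. -/
noncomputable def pjoin {R S : Type*} (f g : R →. S) : R →. S :=
  fun x => ⟨(f x).Dom ∨ (g x).Dom, fun h =>
    if hg : (g x).Dom then (g x).get hg else (f x).get (h.resolve_right hg)⟩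

/-- The empty partial function. -/
def pzero {R S : Type*} : R →. S := fun _ => Part.none

/-- The domain of a partial function, as a set. -/
def pdom {R S : Type*} (f : R →. S) : Set R := {x | (f x).Dom}

theorem pmeet_dom {R S : Type*} (f g : R →. S) (x : R) :
    (pmeet f g x).Dom ↔ (f x).Dom ∧ (g x).Dom :=
  Iff.rfl

theorem pjoin_dom {R S : Type*} (f g : R →. S) (x : R) :
    (pjoin f g x).Dom ↔ (f x).Dom ∨ (g x).Dom :=
  Iff.rfl

theorem not_dom_pzero {R S : Type*} (x : R) : ¬ ((pzero : R →. S) x).Dom :=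
  id

theorem pmeet_get {R S : Type*} (f g : R →. S) (x : R) (h : (pmeet f g x).Dom) :
    (pmeet f g x).get h = (f x).get h.1 :=
  rfl

open Classical in
theorem pjoin_get {R S : Type*} (f g : R →. S) (x : R) (h : (pjoin f g x).Dom) :
    (pjoin f g x).get h =
      if hg : (g x).Dom then (g x).get hg else (f x).get (h.resolve_right hg) :=
  rfl

/-- Partial functions with the same domain and the same values are equal. -/
theorem pfun_ext_get {R S : Type*} {f g : R →. S} (hd : ∀ x, (f x).Dom ↔ (g x).Dom)
    (hv : ∀ x hf hg, (f x).get hf = (g x).get hg) : f = g :=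
  funext fun x => Part.ext' (hd x) (hv x)

/-- On the set `𝒫(R,S)` of partial functions from `R` to `S`, the restriction `∧` and
override `∨` operations are idempotent and associative, satisfy the absorption laws,
the left-handed identities, and the empty partial function is a zero element. -/
theorem partialFunctions_skewLattice (R S : Type*) :
    (∀ f : R →. S, pmeet f f = f) ∧
    (∀ f : R →. S, pjoin f f = f) ∧
    (∀ f g h : R →. S, pmeet (pmeet f g) h = pmeet f (pmeet g h)) ∧
    (∀ f g h : R →. S, pjoin (pjoin f g) h = pjoin f (pjoin g h)) ∧
    (∀ f g : R →. S, pmeet f (pjoin f g) = f) ∧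
    (∀ f g : R →. S, pjoin f (pmeet f g) = f) ∧
    (∀ f g : R →. S, pjoin (pmeet f g) g = g) ∧
    (∀ f g : R →. S, pmeet (pjoin f g) g = g) ∧
    (∀ f g : R →. S, pmeet (pmeet f g) f = pmeet f g) ∧
    (∀ f g : R →. S, pjoin (pjoin f g) f = pjoin g f) ∧
    (∀ f : R →. S, pjoin f pzero = f) ∧
    (∀ f : R →. S, pjoin pzero f = f) ∧
    (∀ f : R →. S, pmeet f pzero = pzero) ∧
    (∀ f : R →. S, pmeet pzero f = pzero) := by
  refine ⟨?_, ?_, ?_, ?_, ?_, ?_, ?_, ?_, ?_, ?_, ?_, ?_, ?_, ?_⟩ <;> intros <;>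
    refine pfun_ext_get (fun x => ?_) (fun x h₁ h₂ => ?_) <;>
    grind [pmeet_dom, pjoin_dom, not_dom_pzero, pmeet_get, pjoin_get]
end

section
/- Every commuting subset C of 𝒫(R,S) (nonempty, with f∧g = g∧f and f∨g = g∨f for all f,g ∈ C, equivalently all members of C pairwise agree on the intersections of their domains) has a supremum with respect to the natural partial order, namely the common extension with domain ⋃_{f∈C} dom f; moreover, for every commuting subset C and every g ∈ 𝒫(R,S), the infinite distributive laws (sup C) ∧ g = sup{f∧g : f ∈ C} and g ∧ (sup C) = sup{g∧f : f ∈ C} hold. Consequently 𝒫(R,S) is a left-handed noncommutative frame. -/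
/-- The natural partial order on a skew lattice with meet `m`: `a ≤ b` iff `a∧b = a = b∧a`. -/
def nleq {α : Type*} (m : α → α → α) (a b : α) : Prop := m a b = a ∧ m b a = a

/-- Green's relation `𝒟`: `a 𝒟 b` iff `a∧b∧a = a` and `b∧a∧b = b`. -/
def DRel {α : Type*} (m : α → α → α) (a b : α) : Prop :=
  m (m a b) a = a ∧ m (m b a) b = b

/-- A commuting subset: a nonempty subset whose members pairwise `∧`- and `∨`-commute. -/
def Commuting {α : Type*} (m j : α → α → α) (C : Set α) : Prop :=
  C.Nonempty ∧ ∀ x ∈ C, ∀ y ∈ C, m x y = m y x ∧ j x y = j y x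

/-- `t` is a top element: its `𝒟`-class is the maximal `𝒟`-class. -/
def IsTopElt {α : Type*} (m j : α → α → α) (t : α) : Prop := ∀ a, DRel m (j a t) t

/-- `s` is the supremum of `C` with respect to the natural partial order. -/
def IsSupOf {α : Type*} (m : α → α → α) (C : Set α) (s : α) : Prop :=
  (∀ x ∈ C, nleq m x s) ∧ ∀ t, (∀ x ∈ C, nleq m x t) → nleq m s t
/-- `IsLNFrame m j z sup` says that the operations `m` (meet), `j` (join), the constant `z`
and the supremum operator `sup` make the carrier type into a left-handed noncommutative frame:
a left-handed strongly distributive join-complete skew lattice with zero `z` satisfying the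
infinite distributive laws over commuting subsets. -/
structure IsLNFrame {α : Type*} (m j : α → α → α) (z : α) (sup : Set α → α) : Prop where
  meet_idem : ∀ x, m x x = x
  join_idem : ∀ x, j x x = x
  meet_assoc : ∀ x y w, m (m x y) w = m x (m y w)
  join_assoc : ∀ x y w, j (j x y) w = j x (j y w)
  absorb₁ : ∀ x y, m x (j x y) = x
  absorb₂ : ∀ x y, j x (m x y) = x
  absorb₃ : ∀ x y, j (m x y) y = y
  absorb₄ : ∀ x y, m (j x y) y = y
  left_handed : ∀ x y, m (m x y) x = m x y
  sdist₁ : ∀ x y w, m (j x y) w = j (m x w) (m y w)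
  sdist₂ : ∀ x y w, m x (j y w) = j (m x y) (m x w)
  join_zero : ∀ x, j x z = x
  zero_join : ∀ x, j z x = x
  meet_zero : ∀ x, m x z = z
  zero_meet : ∀ x, m z x = z
  sup_isSup : ∀ C : Set α, Commuting m j C → IsSupOf m C (sup C)
  inf_dist₁ : ∀ (C : Set α) (y : α), Commuting m j C →
    m (sup C) y = sup ((fun x => m x y) '' C)
  inf_dist₂ : ∀ (C : Set α) (y : α), Commuting m j C →
    m y (sup C) = sup ((fun x => m y x) '' C)

open Classical in
/-- The common extension of a set `C` of partial functions: its domain is the union of the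
domains of the members of `C`, and its value at a point is the value of some member of `C`
defined there. For a commuting subset `C` this is the supremum of `C`. -/
noncomputable def psup {R S : Type*} (C : Set (R →. S)) : R →. S :=
  fun x => ⟨∃ f ∈ C, (f x).Dom,
    fun h => ((Classical.choose h) x).get (Classical.choose_spec h).2⟩

namespace PFun

variable {R S : Type*}

@[simp]
theorem dom_pmeet (f g : R →. S) (x : R) : (pmeet f g x).Dom ↔ (f x).Dom ∧ (g x).Dom :=
  Iff.rfl

@[simp]
theorem dom_pjoin (f g : R →. S) (x : R) : (pjoin f g x).Dom ↔ (f x).Dom ∨ (g x).Dom :=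
  Iff.rfl

@[simp]
theorem dom_psup (C : Set (R →. S)) (x : R) : (psup C x).Dom ↔ ∃ f ∈ C, (f x).Dom :=
  Iff.rfl

@[simp]
theorem mem_pmeet {f g : R →. S} {x : R} {a : S} :
    a ∈ pmeet f g x ↔ a ∈ f x ∧ (g x).Dom := by
  constructor
  · rintro ⟨h, rfl⟩
    exact ⟨⟨h.1, rfl⟩, h.2⟩
  · rintro ⟨⟨h, rfl⟩, hg⟩
    exact ⟨⟨h, hg⟩, rfl⟩

@[simp]
theorem mem_pjoin {f g : R →. S} {x : R} {a : S} :
    a ∈ pjoin f g x ↔ a ∈ g x ∨ a ∈ f x ∧ ¬(g x).Dom := by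
  by_cases hg : (g x).Dom
  · simp [pjoin, Part.mem_eq, hg]
  · simp [pjoin, Part.mem_eq, hg]

@[simp]
theorem notMem_pzero {x : R} {a : S} : a ∉ (pzero : R →. S) x :=
  Part.notMem_none a

@[simp]
theorem not_dom_pzero {x : R} : ¬((pzero : R →. S) x).Dom :=
  id

/-- The members of `C` pairwise agree on the intersections of their domains. -/
def Compatible (C : Set (R →. S)) : Prop :=
  ∀ f ∈ C, ∀ g ∈ C, ∀ x, ∀ a ∈ f x, ∀ b ∈ g x, a = b

theorem compatible_of_commuting {C : Set (R →. S)} (hC : Commuting pmeet pjoin C) :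
    Compatible C := by
  intro f hf g hg x a ha b hb
  have h : a ∈ pmeet f g x := mem_pmeet.2 ⟨ha, Part.dom_iff_mem.2 ⟨b, hb⟩⟩
  rw [(hC.2 f hf g hg).1] at h
  exact Part.mem_unique (mem_pmeet.1 h).1 hb

theorem Compatible.mem_psup {C : Set (R →. S)} (hC : Compatible C) {x : R} {a : S} :
    a ∈ psup C x ↔ ∃ f ∈ C, a ∈ f x := by
  constructor
  · rintro ⟨h, rfl⟩
    exact ⟨_, (Classical.choose_spec h).1, Part.get_mem _⟩
  · rintro ⟨f, hf, ha⟩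
    have h : ∃ f ∈ C, (f x).Dom := ⟨f, hf, Part.dom_iff_mem.2 ⟨a, ha⟩⟩
    exact ⟨h, hC _ (Classical.choose_spec h).1 f hf x _ (Part.get_mem _) a ha⟩

theorem Compatible.pmeet_right {C : Set (R →. S)} (hC : Compatible C) (g : R →. S) :
    Compatible ((fun f => pmeet f g) '' C) := by
  rintro _ ⟨f, hf, rfl⟩ _ ⟨k, hk, rfl⟩ x a ha b hb
  exact hC f hf k hk x a (mem_pmeet.1 ha).1 b (mem_pmeet.1 hb).1

theorem compatible_pmeet_left (C : Set (R →. S)) (g : R →. S) :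
    Compatible ((fun f => pmeet g f) '' C) := by
  rintro _ ⟨f, hf, rfl⟩ _ ⟨k, hk, rfl⟩ x a ha b hb
  exact Part.mem_unique (mem_pmeet.1 ha).1 (mem_pmeet.1 hb).1

theorem Compatible.psup_pmeet {C : Set (R →. S)} (hC : Compatible C) (g : R →. S) :
    pmeet (psup C) g = psup ((fun f => pmeet f g) '' C) := by
  refine PFun.ext fun x a => ?_
  rw [(hC.pmeet_right g).mem_psup, mem_pmeet, hC.mem_psup, Set.exists_mem_image]
  simp only [mem_pmeet]
  tauto

theorem pmeet_psup (C : Set (R →. S)) (g : R →. S) :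
    pmeet g (psup C) = psup ((fun f => pmeet g f) '' C) := by
  refine PFun.ext fun x a => ?_
  rw [(compatible_pmeet_left C g).mem_psup, mem_pmeet, dom_psup, Set.exists_mem_image]
  simp only [mem_pmeet]
  tauto

theorem nleq_pmeet_iff {f g : R →. S} :
    nleq pmeet f g ↔ ∀ x, ∀ a ∈ f x, a ∈ g x := by
  constructor
  · rintro ⟨-, h⟩ x a ha
    rw [← h] at ha
    exact (mem_pmeet.1 ha).1
  · intro h
    refine ⟨PFun.ext fun x a => ?_, PFun.ext fun x a => ?_⟩
    · rw [mem_pmeet]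
      exact ⟨And.left, fun ha => ⟨ha, Part.dom_iff_mem.2 ⟨a, h x a ha⟩⟩⟩
    · rw [mem_pmeet]
      refine ⟨fun ⟨ha, hd⟩ => ?_, fun ha => ⟨h x a ha, Part.dom_iff_mem.2 ⟨a, ha⟩⟩⟩
      obtain ⟨b, hb⟩ := Part.dom_iff_mem.1 hd
      exact Part.mem_unique (h x b hb) ha ▸ hb

theorem Compatible.isSupOf_psup {C : Set (R →. S)} (hC : Compatible C) :
    IsSupOf pmeet C (psup C) := by
  simp only [IsSupOf, nleq_pmeet_iff, hC.mem_psup]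
  exact ⟨fun f hf x a ha => ⟨f, hf, ha⟩, fun t ht x a ⟨f, hf, ha⟩ => ht f hf x a ha⟩

theorem pdom_psup (C : Set (R →. S)) : pdom (psup C) = ⋃ f ∈ C, pdom f := by
  ext x
  simp [pdom]

theorem isLNFrame : IsLNFrame (α := R →. S) pmeet pjoin pzero psup := by
  have dom_of_mem (o : Part S) (a : S) (h : a ∈ o) : o.Dom := Part.dom_iff_mem.2 ⟨a, h⟩
  constructor
  case sup_isSup => exact fun C hC => (compatible_of_commuting hC).isSupOf_psup
  case inf_dist₁ => exact fun C g hC => (compatible_of_commuting hC).psup_pmeet g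
  case inf_dist₂ => exact fun C g _ => pmeet_psup C g
  all_goals
    intros
    refine PFun.ext fun x a => ?_
    simp only [mem_pmeet, mem_pjoin, dom_pmeet, dom_pjoin, notMem_pzero, not_dom_pzero]
    grind

end PFun

/-- Every commuting subset `C` of `𝒫(R,S)` has a supremum with respect to the natural partial
order, namely the common extension `psup C` with domain `⋃_{f ∈ C} dom f`; moreover the
infinite distributive laws hold, and consequently `𝒫(R,S)` is a left-handed noncommutative
frame. -/
theorem partialFunctions_noncommutativeFrame (R S : Type*) :
    (∀ C : Set (R →. S), Commuting pmeet pjoin C →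
      (pdom (psup C) = ⋃ f ∈ C, pdom f) ∧ IsSupOf pmeet C (psup C)) ∧
    (∀ (C : Set (R →. S)) (g : R →. S), Commuting pmeet pjoin C →
      pmeet (psup C) g = psup ((fun f => pmeet f g) '' C) ∧
      pmeet g (psup C) = psup ((fun f => pmeet g f) '' C)) ∧
    IsLNFrame (α := R →. S) pmeet pjoin pzero psup := by
  exact ⟨fun C hC => ⟨PFun.pdom_psup C, (PFun.compatible_of_commuting hC).isSupOf_psup⟩,
    fun C g hC => ⟨(PFun.compatible_of_commuting hC).psup_pmeet g, PFun.pmeet_psup C g⟩,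
    PFun.isLNFrame⟩
end

section
/- Let A be a left-handed noncommutative frame. Let Y_A be the set of maps p : A → {0,1} such that p(x∧y) = min(p(x),p(y)), p(x∨y) = max(p(x),p(y)), p(0) = 0, p(t) = 1 for every top element t, and for every commuting subset C ⊆ A, p(sup C) = 1 iff p(c) = 1 for some c ∈ C; equip Y_A with the topology generated by the sets U_a = {p ∈ Y_A : p(a) = 1} for a ∈ A, and let Y_{A,f} be Y_A with the corresponding front topology. For p ∈ Y_A and a,b ∈ A with p(a) = p(b) = 1, set a ∼_p b iff there exist c,d ∈ A with p(c) = 0, p(d) = 1 and (a∧d)∨c = (b∧d)∨c; this is an equivalence relation on {a ∈ A : p(a) = 1}. Let E_A = {(p, [a]_{∼_p}) : p ∈ Y_A, a ∈ A, p(a) = 1}, let π : E_A → Y_A be π(p,[a]_{∼_p}) = p, for a ∈ A let s_a : U_a → E_A be s_a(p) = (p,[a]_{∼_p}), and equip E_A with the topology generated by the sets s_a(Z) = {(p,[a]_{∼_p}) : p ∈ Z} for a ∈ A and Z ⊆ U_a locally closed in Y_A. Then: (i) for every a ∈ A the map s_a : U_a → E_A is continuous when U_a carries the subspace topology from Y_{A,f};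 and (ii) π : E_A → Y_{A,f} is a local homeomorphism. -/
universe u v

/-- The front topology on a topological space: generated by the open and the closed subsets. -/
def frontTop (Y : Type u) (t : TopologicalSpace Y) : TopologicalSpace Y :=
  TopologicalSpace.generateFrom {s : Set Y | @IsOpen Y t s ∨ @IsClosed Y t s}

theorem frontTop_isOpen {Y : Type u} (t : TopologicalSpace Y) {U : Set Y}
    (hU : @IsOpen Y t U) : @IsOpen Y (frontTop Y t) U :=
  TopologicalSpace.isOpen_generateFrom_of_mem (Or.inl hU)

theorem frontTop_isOpen_diff {Y : Type u} (t : TopologicalSpace Y) {U V : Set Y}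
    (hU : @IsOpen Y t U) (hV : @IsOpen Y t V) : @IsOpen Y (frontTop Y t) (U \ V) := by
  rw [Set.diff_eq]
  exact @IsOpen.inter Y (frontTop Y t) _ _
    (frontTop_isOpen t hU)
    (TopologicalSpace.isOpen_generateFrom_of_mem (Or.inr (@IsOpen.isClosed_compl Y t _ hV)))

section EtaleSpace

variable {A : Type u}

/-- A point of the commutative shadow of a left-handed noncommutative frame `(A, m, j, z, sup)`:
a map `p : A → {0,1}` with `p(x∧y) = min(p x, p y)`, `p(x∨y) = max(p x, p y)`, `p 0 = 0`,
`p t = 1` for every top element `t`, and `p (sup C) = 1` iff `p c = 1` for some `c ∈ C`,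
for every commuting subset `C`. -/
def IsPoint (m j : A → A → A) (z : A) (sup : Set A → A) (p : A → Bool) : Prop :=
  (∀ x y, p (m x y) = (p x && p y)) ∧
  (∀ x y, p (j x y) = (p x || p y)) ∧
  p z = false ∧
  (∀ t, IsTopElt m j t → p t = true) ∧
  ∀ C : Set A, Commuting m j C → (p (sup C) = true ↔ ∃ c ∈ C, p c = true)

/-- The set of points `Y_A`. -/
def YA (m j : A → A → A) (z : A) (sup : Set A → A) : Type u :=
  {p : A → Bool // IsPoint m j z sup p}

/-- The topology on `Y_A` generated by the sets `U_a = {p : p(a) = 1}`. -/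
def tauA (m j : A → A → A) (z : A) (sup : Set A → A) : TopologicalSpace (YA m j z sup) :=
  TopologicalSpace.generateFrom {S | ∃ a : A, S = {p : YA m j z sup | p.1 a = true}}

/-- The basic open set `U_a = {p ∈ Y_A : p(a) = 1}`. -/
def UA (m j : A → A → A) (z : A) (sup : Set A → A) (a : A) : Set (YA m j z sup) :=
  {p | p.1 a = true}

/-- The relation `a ∼_p b`: `a` and `b` agree in `p`, i.e. there are `c, d` with `p c = 0`,
`p d = 1` and `(a∧d)∨c = (b∧d)∨c`. -/
def simRel (m j : A → A → A) (p : A → Bool) (a b : A) : Prop :=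
  ∃ c d : A, p c = false ∧ p d = true ∧ j (m a d) c = j (m b d) c

/-- The equivalence class `[a]_{∼_p}`, as a subset of `A`. -/
def simCls (m j : A → A → A) (p : A → Bool) (a : A) : Set A :=
  {b | p b = true ∧ simRel m j p a b}

/-- The étale space `E_A = {(p, [a]_{∼_p}) : p ∈ Y_A, a ∈ A, p(a) = 1}`. -/
def EA (m j : A → A → A) (z : A) (sup : Set A → A) : Type u :=
  {x : YA m j z sup × Set A // ∃ a : A, x.1.1 a = true ∧ x.2 = simCls m j x.1.1 a}

/-- The projection `π_A : E_A → Y_A`. -/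
def piA (m j : A → A → A) (z : A) (sup : Set A → A) : EA m j z sup → YA m j z sup :=
  fun e => e.1.1

/-- The local section `s_a : U_a → E_A`, `s_a(p) = (p, [a]_{∼_p})`. -/
def sA (m j : A → A → A) (z : A) (sup : Set A → A) (a : A) :
    ↥(UA m j z sup a) → EA m j z sup :=
  fun q => ⟨(q.1, simCls m j q.1.1 a), ⟨a, q.2, rfl⟩⟩

/-- A locally closed subset of `Y_A`: the intersection of an open set and a closed set. -/
def LocClosed (m j : A → A → A) (z : A) (sup : Set A → A) (Z : Set (YA m j z sup)) : Prop :=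
  ∃ O C : Set (YA m j z sup),
    @IsOpen _ (tauA m j z sup) O ∧ @IsClosed _ (tauA m j z sup) C ∧ Z = O ∩ C

/-- The topology on `E_A` generated by the sets `s_a(Z)` for `a ∈ A` and `Z ⊆ U_a`
locally closed in `Y_A`. -/
def tauE (m j : A → A → A) (z : A) (sup : Set A → A) : TopologicalSpace (EA m j z sup) :=
  TopologicalSpace.generateFrom
    {S | ∃ (a : A) (Z : Set (YA m j z sup)), LocClosed m j z sup Z ∧ Z ⊆ UA m j z sup a ∧
      S = sA m j z sup a '' (Subtype.val ⁻¹' Z)}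

namespace IsLNFrame

variable {m j : A → A → A} {z : A} {sup : Set A → A}

/-- The meet of a left-handed strongly distributive skew lattice is left normal. -/
theorem meet_right_comm (h : IsLNFrame m j z sup) (x y w : A) :
    m (m x y) w = m (m x w) y := by
  have absorb : ∀ u v, m (m (m x u) v) (m (m x v) u) = m (m x u) v := fun u v => by
    calc m (m (m x u) v) (m (m x v) u)
        = m (m (m (m x (m u v)) x) v) u := by simp only [h.meet_assoc]
      _ = m x (m u (m (m v v) u)) := by rw [h.left_handed]; simp only [h.meet_assoc]
      _ = m x (m (m u v) u) := by rw [h.meet_idem, h.meet_assoc u]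
      _ = m (m x u) v := by rw [h.left_handed, h.meet_assoc]
  have below : ∀ u v, m x (m (m x u) v) = m (m x u) v := fun u v => by
    rw [← h.meet_assoc, ← h.meet_assoc, h.meet_idem]
  have key := h.sdist₁ x (m (m x y) w) (m (m x w) y)
  rw [h.meet_assoc x y w, h.absorb₂, ← h.meet_assoc x y w, below, absorb] at key
  have := h.absorb₃ (m (m x w) y) (m (m x y) w)
  rw [absorb] at this
  rw [key, this]

theorem meet_join_self (h : IsLNFrame m j z sup) (x y : A) : j (m x y) x = x := by
  simpa only [h.left_handed] using h.absorb₃ (m x y) x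

/-- In a left-handed skew lattice, the join satisfies `x∨y∨x = y∨x`. -/
theorem join_join_self (h : IsLNFrame m j z sup) (x y : A) : j x (j y x) = j y x := by
  have hx : m x (j y x) = x := by
    rw [h.sdist₂, h.meet_idem, h.meet_join_self]
  simpa only [hx] using h.absorb₃ x (j y x)

theorem join_meet_meet (h : IsLNFrame m j z sup) {a b c d : A}
    (hab : j (m a d) c = j (m b d) c) (e : A) :
    j (m (m a d) e) c = j (m (m b d) e) c := by
  have := congrArg (fun x => j (m x e) c) hab
  simpa only [h.sdist₁, h.join_assoc, h.meet_join_self] using this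

theorem simRel_refl (p : YA m j z sup) {a : A} (ha : p.1 a = true) : simRel m j p.1 a a :=
  ⟨z, a, p.2.2.2.1, ha, rfl⟩

theorem simRel_symm {p : A → Bool} {a b : A} :
    simRel m j p a b → simRel m j p b a :=
  fun ⟨c, d, hc, hd, hab⟩ => ⟨c, d, hc, hd, hab.symm⟩

theorem simRel_trans (h : IsLNFrame m j z sup) (p : YA m j z sup) {a b e : A} :
    simRel m j p.1 a b → simRel m j p.1 b e → simRel m j p.1 a e := by
  rintro ⟨c, d, hc, hd, hab⟩ ⟨c', d', hc', hd', hbe⟩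
  refine ⟨j c c', m d d', by simp [p.2.2.1, hc, hc'], by simp [p.2.1, hd, hd'], ?_⟩
  have h₁ := h.join_meet_meet hab d'
  have h₂ := h.join_meet_meet hbe d
  rw [h.meet_right_comm b, h.meet_right_comm e] at h₂
  rw [← h.meet_assoc, ← h.meet_assoc, ← h.join_assoc, h₁, h.join_assoc,
    ← h.join_join_self c' c, ← h.join_assoc, h₂, h.join_assoc]

theorem simCls_eq_iff (h : IsLNFrame m j z sup) (p : YA m j z sup) {a b : A}
    (hb : p.1 b = true) :
    simCls m j p.1 a = simCls m j p.1 b ↔ simRel m j p.1 a b := by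
  constructor
  · intro hab
    have : b ∈ simCls m j p.1 b := ⟨hb, simRel_refl p hb⟩
    rw [← hab] at this
    exact this.2
  · intro hab
    ext x
    exact and_congr_right fun _ =>
      ⟨h.simRel_trans p (simRel_symm hab), h.simRel_trans p hab⟩

theorem isOpen_UA (a : A) : @IsOpen _ (tauA m j z sup) (UA m j z sup a) :=
  TopologicalSpace.isOpen_generateFrom_of_mem ⟨a, rfl⟩

theorem isOpen_frontTop_of_locClosed {Z : Set (YA m j z sup)} (hZ : LocClosed m j z sup Z) :
    @IsOpen _ (frontTop _ (tauA m j z sup)) Z := by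
  obtain ⟨O, C, hO, hC, rfl⟩ := hZ
  exact @IsOpen.inter _ (frontTop _ (tauA m j z sup)) _ _ (frontTop_isOpen _ hO)
    (TopologicalSpace.isOpen_generateFrom_of_mem (Or.inr hC))

theorem locClosed_inter_UA {V : Set (YA m j z sup)}
    (hV : @IsOpen _ (tauA m j z sup) V ∨ @IsClosed _ (tauA m j z sup) V) (a : A) :
    LocClosed m j z sup (V ∩ UA m j z sup a) := by
  let := tauA m j z sup
  rcases hV with hV | hV
  · exact ⟨_, Set.univ, hV.inter (isOpen_UA a), isClosed_univ, (Set.inter_univ _).symm⟩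
  · exact ⟨_, V, isOpen_UA a, hV, Set.inter_comm _ _⟩

theorem isOpen_image_sA {a : A} {Z : Set (YA m j z sup)} (hZ : LocClosed m j z sup Z)
    (hZa : Z ⊆ UA m j z sup a) :
    @IsOpen _ (tauE m j z sup) (sA m j z sup a '' (Subtype.val ⁻¹' Z)) :=
  TopologicalSpace.isOpen_generateFrom_of_mem ⟨a, Z, hZ, hZa, rfl⟩

theorem isOpen_range_sA (a : A) :
    @IsOpen _ (tauE m j z sup) (Set.range (sA m j z sup a)) := by
  let := tauA m j z sup
  have hU : LocClosed m j z sup (Set.univ ∩ UA m j z sup a) :=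
    locClosed_inter_UA (Or.inl isOpen_univ) a
  have := isOpen_image_sA hU Set.inter_subset_right
  rwa [Set.univ_inter, Subtype.coe_preimage_self, Set.image_univ] at this

theorem exists_sA_eq (e : EA m j z sup) : ∃ a q, sA m j z sup a q = e := by
  obtain ⟨⟨p, s⟩, a, ha, hs⟩ := e
  exact ⟨a, ⟨p, ha⟩, Subtype.ext (Prod.ext rfl hs.symm)⟩

theorem continuous_piA :
    @Continuous _ _ (tauE m j z sup) (frontTop _ (tauA m j z sup)) (piA m j z sup) := by
  let := tauE m j z sup
  refine continuous_generateFrom_iff.2 fun V hV => ?_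
  have hpre : piA m j z sup ⁻¹' V = ⋃ a, sA m j z sup a ''
      (Subtype.val ⁻¹' (V ∩ UA m j z sup a)) := by
    ext e
    simp only [Set.mem_iUnion, Set.mem_preimage]
    constructor
    · intro he
      obtain ⟨a, q, rfl⟩ := exists_sA_eq e
      exact ⟨a, q, ⟨he, q.2⟩, rfl⟩
    · rintro ⟨a, q, hq, rfl⟩
      exact hq.1
  rw [hpre]
  exact isOpen_iUnion fun a => isOpen_image_sA (locClosed_inter_UA hV a) Set.inter_subset_right

theorem continuous_sA (h : IsLNFrame m j z sup) (a : A) :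
    @Continuous ↥(UA m j z sup a) (EA m j z sup)
      (TopologicalSpace.induced Subtype.val (frontTop _ (tauA m j z sup)))
      (tauE m j z sup) (sA m j z sup a) := by
  let := frontTop _ (tauA m j z sup)
  refine continuous_generateFrom_iff.2 ?_
  rintro _ ⟨b, Z, hZ, hZb, rfl⟩
  refine isOpen_iff_forall_mem_open.2 ?_
  rintro q ⟨q', hq', hqq⟩
  have hp : q'.1 = q.1 := congrArg (fun e => e.1.1) hqq
  have hcls : simCls m j q'.1.1 b = simCls m j q.1.1 a := congrArg (fun e => e.1.2) hqq
  have hqZ : q.1 ∈ Z := hp ▸ hq'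
  rw [hp] at hcls
  obtain ⟨c, d, hc, hd, hab⟩ := (h.simCls_eq_iff q.1 (hZb hqZ)).1 hcls.symm
  refine ⟨Subtype.val ⁻¹' (Z ∩ (UA m j z sup d \ UA m j z sup c)), ?_, ?_, ?_⟩
  · rintro r ⟨hrZ, hrd, hrc⟩
    refine ⟨⟨r.1, hZb hrZ⟩, hrZ, Subtype.ext (Prod.ext rfl ?_)⟩
    exact ((h.simCls_eq_iff r.1 (hZb hrZ)).2 ⟨c, d, Bool.eq_false_iff.2 hrc, hrd, hab⟩).symm
  · exact ((isOpen_frontTop_of_locClosed hZ).inter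
      (frontTop_isOpen_diff _ (isOpen_UA d) (isOpen_UA c))).preimage continuous_subtype_val
  · exact ⟨hqZ, hd, Bool.eq_false_iff.1 hc⟩

theorem isLocalHomeomorph_piA (h : IsLNFrame m j z sup) :
    @IsLocalHomeomorph (EA m j z sup) (YA m j z sup)
      (tauE m j z sup) (frontTop _ (tauA m j z sup)) (piA m j z sup) := by
  let := tauE m j z sup
  let := frontTop _ (tauA m j z sup)
  classical
  refine IsLocalHomeomorph.mk _ fun e => ?_
  obtain ⟨a, q, rfl⟩ := exists_sA_eq e
  let g : YA m j z sup → EA m j z sup := fun p =>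
    if hp : p ∈ UA m j z sup a then sA m j z sup a ⟨p, hp⟩ else sA m j z sup a q
  have hg : ∀ r : UA m j z sup a, g r = sA m j z sup a r := fun r => dif_pos r.2
  refine ⟨{ toFun := piA m j z sup
            invFun := g
            source := Set.range (sA m j z sup a)
            target := UA m j z sup a
            map_source' := ?_
            map_target' := fun p hp => ⟨⟨p, hp⟩, (hg ⟨p, hp⟩).symm⟩
            left_inv' := ?_
            right_inv' := fun p hp => congrArg (piA m j z sup) (hg ⟨p, hp⟩)
            open_source := isOpen_range_sA a
            open_target := frontTop_isOpen _ (isOpen_UA a)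
            continuousOn_toFun := continuous_piA.continuousOn
            continuousOn_invFun := ?_ }, ⟨q, rfl⟩, fun _ _ => rfl⟩
  · rintro _ ⟨r, rfl⟩
    exact r.2
  · rintro _ ⟨r, rfl⟩
    exact hg r
  · rw [continuousOn_iff_continuous_domRestrict]
    exact (h.continuous_sA a).congr fun r => (hg r).symm

end IsLNFrame

/-- For a left-handed noncommutative frame `A`: the relation `∼_p` is an equivalence relation
on `{a : p(a) = 1}` for each point `p`; each map `s_a : U_a → E_A` is continuous for the
subspace topology induced by the front topology on `Y_A`; and the projection
`π_A : E_A → Y_{A,f}` is a local homeomorphism. -/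
theorem etaleSpace_of_LNFrame (m j : A → A → A) (z : A) (sup : Set A → A)
    (hA : IsLNFrame m j z sup) :
    (∀ p : YA m j z sup,
      (∀ a, p.1 a = true → simRel m j p.1 a a) ∧
      (∀ a b, p.1 a = true → p.1 b = true →
        simRel m j p.1 a b → simRel m j p.1 b a) ∧
      (∀ a b c, p.1 a = true → p.1 b = true → p.1 c = true →
        simRel m j p.1 a b → simRel m j p.1 b c → simRel m j p.1 a c)) ∧
    (∀ a : A,
      @Continuous ↥(UA m j z sup a) (EA m j z sup)
        (TopologicalSpace.induced Subtype.val (frontTop _ (tauA m j z sup)))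
        (tauE m j z sup) (sA m j z sup a)) ∧
    @IsLocalHomeomorph (EA m j z sup) (YA m j z sup)
      (tauE m j z sup) (frontTop _ (tauA m j z sup)) (piA m j z sup) := by
  refine ⟨fun p => ⟨fun a => IsLNFrame.simRel_refl p, fun _ _ _ _ => IsLNFrame.simRel_symm,
    fun _ _ _ _ _ _ => hA.simRel_trans p⟩, hA.continuous_sA, hA.isLocalHomeomorph_piA⟩

end EtaleSpace
end

section
/- The prime spectrum of ℤ with its front topology (the topology generated by the Zariski-open and the Zariski-closed subsets of Spec ℤ) is homeomorphic to the subspace {0} ∪ {1/n : n a positive natural number} of ℝ with the Euclidean topology. -/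
universe u v

/-- An infinite countable space in which `p` is the only accumulation point and the open
neighbourhoods of `p` are the cofinite sets is determined up to homeomorphism. -/
theorem nonempty_homeomorph_of_isOpen_iff_finite_compl {X Y : Type*}
    [TopologicalSpace X] [TopologicalSpace Y] [Countable X] [Infinite X] [Countable Y] [Infinite Y]
    (p : X) (q : Y) (hX : ∀ U : Set X, IsOpen U ↔ (p ∈ U → Uᶜ.Finite))
    (hY : ∀ U : Set Y, IsOpen U ↔ (q ∈ U → Uᶜ.Finite)) : Nonempty (X ≃ₜ Y) := by
  classical
  obtain ⟨e₀⟩ := nonempty_equiv_of_countable (α := X) (β := Y)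
  let e : X ≃ Y := e₀.trans (Equiv.swap (e₀ p) q)
  have he : e p = q := by simp [e]
  refine ⟨e.toHomeomorph fun U => ?_⟩
  rw [hX, hY, Set.mem_preimage, he, ← Set.preimage_compl, ← e.image_symm_eq_preimage,
    Set.finite_image_iff e.symm.injective.injOn]

theorem PrimeSpectrum.finite_zeroLocus_of_ne_bot {R : Type*} [CommRing R] [IsDomain R]
    [IsNoetherianRing R] [Ring.DimensionLEOne R]
    {I : Ideal R} (hI : I ≠ ⊥) : (PrimeSpectrum.zeroLocus (I : Set R)).Finite := by
  refine Set.Finite.of_finite_image (f := PrimeSpectrum.asIdeal)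
    (I.finite_minimalPrimes_of_isNoetherianRing.subset ?_)
    (fun _ _ _ _ => PrimeSpectrum.ext)
  rintro _ ⟨x, hx, rfl⟩
  refine ⟨⟨x.isPrime, hx⟩, fun J hJ hle => ?_⟩
  exact ((hJ.1.isMaximal (ne_bot_of_le_ne_bot hI hJ.2)).eq_of_le x.isPrime.ne_top hle).ge

theorem isOpen_frontTop_primeSpectrum_iff {R : Type*} [CommRing R] [IsDomain R]
    [IsNoetherianRing R] [Ring.DimensionLEOne R]
    (U : Set (PrimeSpectrum R)) :
    @IsOpen _ (frontTop (PrimeSpectrum R) inferInstance) U ↔ (⊥ ∈ U → Uᶜ.Finite) := by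
  have hclosed : ∀ x : PrimeSpectrum R, x ≠ ⊥ → IsClosed {x} := fun x hx => by
    rw [PrimeSpectrum.isClosed_singleton_iff_isMaximal]
    exact x.isPrime.isMaximal fun h => hx (PrimeSpectrum.ext h)
  constructor
  · intro h
    induction h with
    | basic s hs =>
      intro hbot
      rcases hs with hs | hs
      · obtain ⟨I, hI⟩ := (PrimeSpectrum.isClosed_iff_zeroLocus_ideal _).1 hs.isClosed_compl
        rw [hI]
        refine PrimeSpectrum.finite_zeroLocus_of_ne_bot ?_
        rintro rfl
        have : (⊥ : PrimeSpectrum R) ∈ sᶜ := by rw [hI]; simp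
        exact this hbot
      · obtain ⟨I, rfl⟩ := (PrimeSpectrum.isClosed_iff_zeroLocus_ideal _).1 hs
        have : I = ⊥ := le_bot_iff.1 hbot
        subst this
        simp
    | univ => simp
    | inter s t _ _ hs ht =>
      intro h
      rw [Set.compl_inter]
      exact (hs h.1).union (ht h.2)
    | sUnion S _ ih =>
      rintro ⟨s, hs, hbot⟩
      exact (ih s hs hbot).subset (Set.compl_subset_compl.2 (Set.subset_sUnion_of_mem hs))
  · intro h
    by_cases hbot : ⊥ ∈ U
    · refine frontTop_isOpen _ (isClosed_compl_iff.1 ?_)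
      rw [← Set.biUnion_of_singleton Uᶜ]
      exact (h hbot).isClosed_biUnion fun x hx => hclosed x fun hx' => hx (hx' ▸ hbot)
    · rw [← Set.biUnion_of_singleton U]
      refine @isOpen_biUnion _ _ (frontTop (PrimeSpectrum R) inferInstance) _ _ fun x hx => ?_
      exact TopologicalSpace.isOpen_generateFrom_of_mem
        (Or.inr (hclosed x fun hx' => hbot (hx' ▸ hx)))

theorem isOpen_iff_finite_compl_of_finite_gt {S : Set ℝ} (h0 : (0 : ℝ) ∈ S)
    (hnn : ∀ x ∈ S, 0 ≤ x) (hfin : ∀ ε > 0, {x ∈ S | ε < x}.Finite) (U : Set S) :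
    IsOpen U ↔ ((⟨0, h0⟩ : S) ∈ U → Uᶜ.Finite) := by
  have hfin' : ∀ ε > 0, {x : S | ε < (x : ℝ)}.Finite := fun ε hε =>
    Set.Finite.of_finite_image ((hfin ε hε).subset (by rintro _ ⟨x, hx, rfl⟩; exact ⟨x.2, hx⟩))
      Subtype.val_injective.injOn
  constructor
  · intro hU h
    obtain ⟨ε, hε, hb⟩ := Metric.isOpen_iff.1 hU _ h
    refine (hfin' (ε / 2) (half_pos hε)).subset fun x hx => ?_
    by_contra hlt
    refine hx (hb ?_)
    have := hnn x x.2
    rw [Set.mem_ofPred_eq, not_lt] at hlt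
    rw [Metric.mem_ball, Subtype.dist_eq, Real.dist_eq, sub_zero, abs_of_nonneg this]
    linarith
  · intro h
    by_cases hbot : (⟨0, h0⟩ : S) ∈ U
    · exact isClosed_compl_iff.1 (h hbot).isClosed
    · rw [← Set.biUnion_of_singleton U]
      refine isOpen_biUnion fun x hx => ?_
      have hpos : 0 < (x : ℝ) := lt_of_le_of_ne (hnn x x.2) fun hx' =>
        hbot (by rwa [show (⟨0, h0⟩ : S) = x from Subtype.ext hx'])
      exact isOpen_singleton_of_finite_mem_nhds x
        ((isOpen_lt continuous_const continuous_subtype_val).mem_nhds (half_lt_self hpos))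
        (hfin' _ (half_pos hpos))

theorem finite_reciprocals_gt {ε : ℝ} (hε : 0 < ε) :
    {x ∈ (({0} ∪ {x : ℝ | ∃ n : ℕ, 0 < n ∧ x = 1 / (n : ℝ)}) : Set ℝ) | ε < x}.Finite := by
  refine ((Set.finite_Iic ⌊1 / ε⌋₊).image fun n : ℕ => 1 / (n : ℝ)).subset ?_
  rintro x ⟨rfl | ⟨n, hn, rfl⟩, hx⟩
  · exact absurd hx hε.not_gt
  · refine ⟨n, Nat.le_floor ?_, rfl⟩
    have hn' : (0 : ℝ) < n := Nat.cast_pos.2 hn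
    exact ((lt_one_div hε hn').1 hx).le

theorem countable_ideal_of_isPrincipalIdealRing {R : Type*} [CommRing R] [IsPrincipalIdealRing R]
    [Countable R] : Countable (Ideal R) :=
  Function.Surjective.countable (f := fun a : R => Ideal.span {a}) fun I =>
    ⟨_, Ideal.span_singleton_generator I⟩

theorem infinite_primeSpectrum_int : Infinite (PrimeSpectrum ℤ) := by
  refine Infinite.of_injective (fun p : Nat.Primes => ⟨Ideal.span {((p : ℕ) : ℤ)},
    (Ideal.span_singleton_prime (by exact_mod_cast p.2.ne_zero)).2
      (Nat.prime_iff_prime_int.1 p.2)⟩) fun p q h => ?_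
  have h' := Ideal.span_singleton_eq_span_singleton.1 (congrArg PrimeSpectrum.asIdeal h)
  rw [Int.associated_iff_natAbs] at h'
  exact Subtype.ext (by simpa using h')

/-- The prime spectrum of `ℤ` equipped with the front topology (generated by the
Zariski-open and Zariski-closed subsets) is homeomorphic to the subspace
`{0} ∪ {1/n : n ∈ ℕ, n > 0}` of `ℝ` with the Euclidean topology. -/
theorem specZ_frontTopology_homeomorph :
    Nonempty
      (@Homeomorph (PrimeSpectrum ℤ)
        ↥(({0} ∪ {x : ℝ | ∃ n : ℕ, 0 < n ∧ x = 1 / (n : ℝ)}) : Set ℝ)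
        (frontTop (PrimeSpectrum ℤ) inferInstance) inferInstance) := by
  have hinf : (({0} ∪ {x : ℝ | ∃ n : ℕ, 0 < n ∧ x = 1 / (n : ℝ)}) : Set ℝ).Infinite :=
    Set.infinite_of_injective_forall_mem (f := fun n : ℕ => 1 / ((n : ℝ) + 1))
      (fun m n h => by simpa using h) fun n => Or.inr ⟨n + 1, n.succ_pos, by push_cast; rfl⟩
  have hcount : (({0} ∪ {x : ℝ | ∃ n : ℕ, 0 < n ∧ x = 1 / (n : ℝ)}) : Set ℝ).Countable :=
    (Set.countable_singleton _).union <|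
      (Set.countable_range fun n : ℕ => 1 / (n : ℝ)).mono <| by
        rintro x ⟨n, _, rfl⟩
        exact ⟨n, rfl⟩
  have := hinf.to_subtype
  have := hcount.to_subtype
  have := infinite_primeSpectrum_int
  have := countable_ideal_of_isPrincipalIdealRing (R := ℤ)
  have : Countable (PrimeSpectrum ℤ) :=
    Function.Injective.countable (f := PrimeSpectrum.asIdeal) fun _ _ => PrimeSpectrum.ext
  refine @nonempty_homeomorph_of_isOpen_iff_finite_compl _ _
    (frontTop (PrimeSpectrum ℤ) inferInstance) _ _ _ _ _ ⊥ _ isOpen_frontTop_primeSpectrum_iff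
    (isOpen_iff_finite_compl_of_finite_gt (Or.inl rfl) ?_ fun ε => finite_reciprocals_gt)
  rintro x (rfl | ⟨n, _, rfl⟩)
  · exact le_rfl
  · positivity
end

section
/- Let I be a set, let U_i ⊆ ℝ be open (for the Euclidean topology) for each i ∈ I, and let f_i : U_i → {0,1} be functions such that for all i,j ∈ I the set {x ∈ U_i ∩ U_j : f_i(x) ≠ f_j(x)} is countable. Then there exists a function f : ⋃_{i∈I} U_i → {0,1} such that for every i ∈ I the set {x ∈ U_i : f(x) ≠ f_i(x)} is countable; moreover, if g : ⋃_{i∈I} U_i → {0,1} is any other function such that {x ∈ U_i : g(x) ≠ f_i(x)} is countable for every i, then {x ∈ ⋃_i U_i : f(x) ≠ g(x)} is countable. -/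
/-- Let `U_i ⊆ ℝ` be open sets and `f_i : U_i → {0,1}` functions such that any two of them
disagree on an at most countable set. Then there is a function `F` on `⋃ᵢ U_i` agreeing with
each `f_i` outside a countable set, and `F` is unique up to countable discrepancy. -/
theorem almost_matching_families_glue {I : Type*} (U : I → Set ℝ)
    (hU : ∀ i, IsOpen (U i)) (f : ∀ i, ↥(U i) → Bool)
    (hf : ∀ i k, {x : ℝ | ∃ (hi : x ∈ U i) (hk : x ∈ U k),
      f i ⟨x, hi⟩ ≠ f k ⟨x, hk⟩}.Countable) :
    ∃ F : ↥(⋃ i, U i) → Bool,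
      (∀ i, {x : ℝ | ∃ (hi : x ∈ U i) (hx : x ∈ ⋃ i, U i),
        F ⟨x, hx⟩ ≠ f i ⟨x, hi⟩}.Countable) ∧
      ∀ G : ↥(⋃ i, U i) → Bool,
        (∀ i, {x : ℝ | ∃ (hi : x ∈ U i) (hx : x ∈ ⋃ i, U i),
          G ⟨x, hx⟩ ≠ f i ⟨x, hi⟩}.Countable) →
        {x : ℝ | ∃ hx : x ∈ ⋃ i, U i, F ⟨x, hx⟩ ≠ G ⟨x, hx⟩}.Countable := by
  obtain ⟨T, hT, hTU⟩ := TopologicalSpace.isOpen_iUnion_countable U hU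
  have hcover : ∀ x : ↥(⋃ i, U i), ∃ k ∈ T, (x : ℝ) ∈ U k := fun x => by
    simpa only [Set.mem_iUnion, exists_prop] using hTU.ge x.2
  choose c hcT hcU using hcover
  refine ⟨fun x => f (c x) ⟨x, hcU x⟩, fun i => ?_, fun G hG => ?_⟩
  · refine (hT.biUnion fun k _ => hf k i).mono ?_
    rintro x ⟨hi, hx, hne⟩
    exact Set.mem_biUnion (hcT ⟨x, hx⟩) ⟨hcU ⟨x, hx⟩, hi, hne⟩
  · refine (hT.biUnion fun k _ => hG k).mono ?_
    rintro x ⟨hx, hne⟩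
    exact Set.mem_biUnion (hcT ⟨x, hx⟩) ⟨hcU ⟨x, hx⟩, hx, hne.symm⟩
end

section
/- Let I be a set, let U_i ⊆ ℝ be open (for the Euclidean topology) for each i ∈ I, and let f_i : U_i → {0,1} be functions such that {x ∈ U_i : f_i(x) = 1} is countable for every i and f_i and f_j agree on U_i ∩ U_j for all i,j ∈ I. Then the unique common extension f : ⋃_{i∈I} U_i → {0,1} of the f_i satisfies that {x ∈ ⋃_i U_i : f(x) = 1} is countable. -/
/-- Let `U_i ⊆ ℝ` be open sets and `f_i : U_i → {0,1}` functions agreeing on overlaps, such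
that each set `{x ∈ U_i : f_i(x) = 1}` is countable. Then the common extension
`F : ⋃ᵢ U_i → {0,1}` of the `f_i` satisfies that `{x : F(x) = 1}` is countable. -/
theorem countable_support_glue {I : Type*} (U : I → Set ℝ)
    (hU : ∀ i, IsOpen (U i)) (f : ∀ i, ↥(U i) → Bool)
    (hcount : ∀ i, {x : ℝ | ∃ hi : x ∈ U i, f i ⟨x, hi⟩ = true}.Countable)
    (hagree : ∀ i k (x : ℝ) (hi : x ∈ U i) (hk : x ∈ U k), f i ⟨x, hi⟩ = f k ⟨x, hk⟩)
    (F : ↥(⋃ i, U i) → Bool)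
    (hF : ∀ i (x : ℝ) (hi : x ∈ U i) (hx : x ∈ ⋃ i, U i), F ⟨x, hx⟩ = f i ⟨x, hi⟩) :
    {x : ℝ | ∃ hx : x ∈ ⋃ i, U i, F ⟨x, hx⟩ = true}.Countable := by
  obtain ⟨T, hT, hTU⟩ := TopologicalSpace.isOpen_iUnion_countable U hU
  refine (hT.biUnion fun i _ => hcount i).mono ?_
  rintro x ⟨hx, hFx⟩
  obtain ⟨i, hiT, hi⟩ := Set.mem_iUnion₂.1 (hTU.symm ▸ hx : x ∈ ⋃ i ∈ T, U i)
  exact Set.mem_biUnion hiT ⟨hi, (hF i x hi hx).symm.trans hFx⟩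
end

section
/- Let A and A' be left-handed noncommutative frames and let φ : A → A' be a map satisfying φ(x∧y) = φ(x)∧φ(y), φ(x∨y) = φ(x)∨φ(y), φ(0) = 0, and which is proper (for every y ∈ A' there is x ∈ A with y ≤ φ(x)). Suppose that the induced map on commutative shadows preserves arbitrary joins, i.e. for every commuting subset C ⊆ A, the element φ(sup C) is 𝒟-related to sup{φ(c) : c ∈ C}. Then φ preserves suprema of commuting subsets: φ(sup C) = sup{φ(c) : c ∈ C} for every commuting subset C ⊆ A; in particular φ is a morphism of noncommutative frames. -/
/-- Elements that are comparable and `𝒟`-related are equal. -/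
theorem eq_of_nleq_of_dRel {α : Type*} {m : α → α → α} {a b : α}
    (hab : nleq m a b) (hD : DRel m b a) : b = a := by
  have h := hD.1
  rw [hab.2, hab.1] at h
  exact h.symm

/-- A multiplicative map sends commuting subsets to commuting subsets. -/
theorem Commuting.image {α β : Type*} {m j : α → α → α} {m' j' : β → β → β} {φ : α → β}
    (hm : ∀ x y, φ (m x y) = m' (φ x) (φ y)) (hj : ∀ x y, φ (j x y) = j' (φ x) (φ y))
    {C : Set α} (hC : Commuting m j C) : Commuting m' j' (φ '' C) := by
  refine ⟨hC.1.image φ, ?_⟩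
  rintro _ ⟨x, hx, rfl⟩ _ ⟨y, hy, rfl⟩
  obtain ⟨h₁, h₂⟩ := hC.2 x hx y hy
  rw [← hm, ← hm, ← hj, ← hj, h₁, h₂]
  exact ⟨rfl, rfl⟩

/-- In a left-handed noncommutative frame, `t` is a top element iff `a ∨ t = t` for all `a`. -/
theorem IsLNFrame.isTopElt_iff {α : Type*} {m j : α → α → α} {z : α} {sup : Set α → α}
    (hA : IsLNFrame m j z sup) {t : α} : IsTopElt m j t ↔ ∀ a, j a t = t := by
  refine ⟨fun ht a => ?_, fun ht a => ?_⟩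
  · have h := (ht a).1
    rw [hA.absorb₄] at h
    have h' := hA.left_handed t (j a t)
    rw [h, hA.absorb₄] at h'
    exact h'.symm
  · rw [ht a]
    exact ⟨by rw [hA.meet_idem, hA.meet_idem], by rw [hA.meet_idem, hA.meet_idem]⟩

/-- Let `A`, `A'` be left-handed noncommutative frames and `φ : A → A'` a proper map
preserving `∧`, `∨` and `0`.  If the induced map on commutative shadows preserves arbitrary
joins (i.e. `φ(sup C)` is `𝒟`-related to `sup (φ '' C)` for every commuting `C ⊆ A`), then
`φ` preserves suprema of commuting subsets: `φ(sup C) = sup (φ '' C)`; in particular `φ` is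
a morphism of noncommutative frames (it also sends top elements to top elements). -/
theorem morphism_of_shadow_frame_morphism {α β : Type*}
    (m j : α → α → α) (z : α) (sup : Set α → α)
    (m' j' : β → β → β) (z' : β) (sup' : Set β → β)
    (hA : IsLNFrame m j z sup) (hB : IsLNFrame m' j' z' sup')
    (φ : α → β)
    (hm : ∀ x y, φ (m x y) = m' (φ x) (φ y))
    (hj : ∀ x y, φ (j x y) = j' (φ x) (φ y))
    (hz : φ z = z')
    (hproper : ∀ y : β, ∃ x : α, nleq m' y (φ x))
    (hshadow : ∀ C : Set α, Commuting m j C → DRel m' (φ (sup C)) (sup' (φ '' C))) :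
    (∀ C : Set α, Commuting m j C → φ (sup C) = sup' (φ '' C)) ∧
    (∀ t : α, IsTopElt m j t → IsTopElt m' j' (φ t)) := by
  refine ⟨fun C hC => ?_, fun t ht => hB.isTopElt_iff.2 fun b => ?_⟩
  · refine eq_of_nleq_of_dRel ((hB.sup_isSup _ (hC.image hm hj)).2 _ ?_) (hshadow C hC)
    rintro _ ⟨c, hc, rfl⟩
    obtain ⟨h₁, h₂⟩ := (hA.sup_isSup C hC).1 c hc
    exact ⟨by rw [← hm, h₁], by rw [← hm, h₂]⟩
  · obtain ⟨x, hx, -⟩ := hproper b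
    have hbx : j' b (φ x) = φ x := by
      have h := hB.absorb₃ b (φ x)
      rwa [hx] at h
    have hxt : j' (φ x) (φ t) = φ t := by rw [← hj, hA.isTopElt_iff.1 ht x]
    rw [← hxt, ← hB.join_assoc, hbx]
end

section
/- Let A be a left-handed noncommutative frame and suppose there exist sets R, S and an injective map i : A → 𝒫(R,S) into the noncommutative frame of partial functions from R to S that preserves ∧, ∨, 0, sends top elements to top elements (total functions), and preserves suprema of commuting subsets. Then for all a, b ∈ A with a 𝒟 b and a ≠ b there exists a map q : A → P₃, where P₃ = {0, 1ₐ, 1_b} is the primitive left-handed skew lattice with operations x∧0 = 0∧x = 0, x∨0 = 0∨x = x for all x, and x∧y = x, x∨y = y for x, y ∈ {1ₐ, 1_b}, such that q preserves ∧, ∨ and 0, sends every top element of A into {1ₐ, 1_b}, preserves suprema of commuting subsets, and satisfies q(a) = 1ₐ and q(b) = 1_b. -/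
/-- The primitive left-handed skew lattice `P₃ = {0, 1ₐ, 1_b}` with two top elements. -/
inductive P3 : Type
  | zero : P3
  | ta : P3
  | tb : P3

/-- The meet of `P₃`: `x∧0 = 0∧x = 0`, and `x∧y = x` for top elements `x, y`. -/
def m3 : P3 → P3 → P3
  | P3.zero, _ => P3.zero
  | _, P3.zero => P3.zero
  | x, _ => x

/-- The join of `P₃`: `x∨0 = 0∨x = x`, and `x∨y = y` for top elements `x, y`. -/
def j3 : P3 → P3 → P3
  | P3.zero, y => y
  | x, P3.zero => x
  | _, y => y

open Classical in
/-- The map from partial elements of `S` to `P₃` sending `c` to `1ₐ`, every other element of `S`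
to `1_b`, and the undefined element to `0`. -/
noncomputable def partToP3 {S : Type*} (c : S) (p : Part S) : P3 :=
  if h : p.Dom then (if p.get h = c then P3.ta else P3.tb) else P3.zero

/-- Evaluation of a partial function at `r`, followed by `partToP3 c`. -/
noncomputable def evalP3 {R S : Type*} (r : R) (c : S) (f : R →. S) : P3 := partToP3 c (f r)

section evalP3

variable {R S : Type*} (r : R) (c : S)

theorem evalP3_eq_zero_iff (f : R →. S) : evalP3 r c f = P3.zero ↔ ¬ (f r).Dom := by
  unfold evalP3 partToP3
  split_ifs <;> simp_all

theorem evalP3_of_dom {r : R} {f : R →. S} (h : (f r).Dom) :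
    evalP3 r c f = P3.ta ∨ evalP3 r c f = P3.tb := by
  by_cases hc : (f r).get h = c
  · exact Or.inl ((dif_pos h).trans (if_pos hc))
  · exact Or.inr ((dif_pos h).trans (if_neg hc))

theorem evalP3_congr {r : R} {f g : R →. S} (h : f r = g r) : evalP3 r c f = evalP3 r c g :=
  congrArg (partToP3 c) h

theorem evalP3_pmeet (f g : R →. S) :
    evalP3 r c (pmeet f g) = m3 (evalP3 r c f) (evalP3 r c g) := by
  by_cases hg : (g r).Dom
  · have h : pmeet f g r = f r := Part.ext' ⟨And.left, fun h => ⟨h, hg⟩⟩ fun _ _ => rfl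
    rw [evalP3_congr c h]
    obtain hg' | hg' := evalP3_of_dom c hg <;> rw [hg'] <;> cases evalP3 r c f <;> rfl
  · rw [(evalP3_eq_zero_iff r c g).2 hg, (evalP3_eq_zero_iff r c (pmeet f g)).2 fun h => hg h.2]
    cases evalP3 r c f <;> rfl

theorem evalP3_pjoin (f g : R →. S) :
    evalP3 r c (pjoin f g) = j3 (evalP3 r c f) (evalP3 r c g) := by
  by_cases hg : (g r).Dom
  · have h : pjoin f g r = g r := Part.ext' ⟨fun _ => hg, Or.inr⟩ fun _ _ => dif_pos hg
    rw [evalP3_congr c h]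
    obtain hg' | hg' := evalP3_of_dom c hg <;> rw [hg'] <;> cases evalP3 r c f <;> rfl
  · have h : pjoin f g r = f r :=
      Part.ext' ⟨fun h => h.resolve_right hg, Or.inl⟩ fun _ _ => dif_neg hg
    rw [evalP3_congr c h, (evalP3_eq_zero_iff r c g).2 hg]
    cases evalP3 r c f <;> rfl

theorem m3_zero_left (t : P3) : m3 P3.zero t = P3.zero := by cases t <;> rfl

theorem m3_zero_right (t : P3) : m3 t P3.zero = P3.zero := by cases t <;> rfl

theorem nleq_m3_zero (t : P3) : nleq m3 P3.zero t := ⟨m3_zero_left t, m3_zero_right t⟩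

theorem eq_of_nleq_m3 {x y : P3} (hx : x ≠ P3.zero) (h : nleq m3 x y) : x = y := by
  cases x <;> cases y <;> simp_all [nleq, m3]

/-- If no member of `C` is defined at `r`, then neither is its supremum. -/
theorem not_dom_of_isSupOf_pmeet {r : R} {C : Set (R →. S)} {s : R →. S} (hs : IsSupOf pmeet C s)
    (hC : ∀ f ∈ C, ¬ (f r).Dom) : ¬ (s r).Dom := by
  intro hr
  let t : R →. S := fun x => ⟨(s x).Dom ∧ x ≠ r, fun h => (s x).get h.1⟩
  have ht : nleq pmeet s t := by
    refine hs.2 t fun f hf => ?_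
    obtain ⟨h₁, h₂⟩ := hs.1 f hf
    have hne : ∀ x, (f x).Dom → x ≠ r := fun x hx hxr => hC f hf (hxr ▸ hx)
    constructor <;> funext x
    · refine Part.ext' ⟨fun h => h.1, fun h => ⟨h, ?_, hne x h⟩⟩ fun _ _ => rfl
      rw [← h₁] at h
      exact h.2
    · have h₂x := congrFun h₂ x
      rw [← h₂x]
      refine Part.ext' ⟨fun h => ⟨h.1.1, h.2⟩, fun h => ⟨⟨h.1, hne x h.2⟩, h.2⟩⟩ fun _ _ => rfl
  have hd : (pmeet s t r).Dom := by rw [ht.1]; exact hr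
  exact hd.2.2 rfl

theorem isSupOf_evalP3 {C : Set (R →. S)} {s : R →. S} (hs : IsSupOf pmeet C s) :
    IsSupOf m3 (evalP3 r c '' C) (evalP3 r c s) := by
  have hub : ∀ f ∈ C, nleq m3 (evalP3 r c f) (evalP3 r c s) := fun f hf => by
    obtain ⟨h₁, h₂⟩ := hs.1 f hf
    exact ⟨by rw [← evalP3_pmeet, h₁], by rw [← evalP3_pmeet, h₂]⟩
  refine ⟨by rintro _ ⟨f, hf, rfl⟩; exact hub f hf, fun t ht => ?_⟩
  by_cases hC : ∀ f ∈ C, ¬ (f r).Dom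
  · rw [(evalP3_eq_zero_iff r c s).2 (not_dom_of_isSupOf_pmeet hs hC)]
    exact nleq_m3_zero t
  · push Not at hC
    obtain ⟨f, hf, hfr⟩ := hC
    have hne : evalP3 r c f ≠ P3.zero := fun h => (evalP3_eq_zero_iff r c f).1 h hfr
    rw [← eq_of_nleq_m3 hne (hub f hf)]
    exact ht _ ⟨f, hf, rfl⟩

end evalP3

/-- Distinct `𝒟`-related partial functions are separated by some `evalP3`. -/
theorem exists_evalP3_of_DRel {R S : Type*} {f g : R →. S} (hD : DRel pmeet f g) (hne : f ≠ g) :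
    ∃ (r : R) (c : S), evalP3 r c f = P3.ta ∧ evalP3 r c g = P3.tb := by
  by_contra! h
  refine hne (funext fun r => Part.ext' ⟨fun hf => ?_, fun hg => ?_⟩ fun hf hg => ?_)
  · rw [← hD.1] at hf
    exact hf.1.2
  · rw [← hD.2] at hg
    exact hg.1.2
  · by_contra hfg
    exact h r _ ((dif_pos hf).trans (if_pos rfl)) ((dif_pos hg).trans (if_neg (Ne.symm hfg)))

/-- Let `A` be a left-handed noncommutative frame admitting an embedding (injective morphism
of noncommutative frames) into some `𝒫(R,S)`.  Then any two distinct `𝒟`-related elements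
`a, b` of `A` can be separated by a morphism of noncommutative frames `q : A → P₃` with
`q a = 1ₐ` and `q b = 1_b`. -/
theorem separation_of_embedded {α R S : Type*}
    (m j : α → α → α) (z : α) (sup : Set α → α) (hA : IsLNFrame m j z sup)
    (i : α → R →. S) (hinj : Function.Injective i)
    (him : ∀ x y, i (m x y) = pmeet (i x) (i y))
    (hij : ∀ x y, i (j x y) = pjoin (i x) (i y))
    (hiz : i z = pzero)
    (hitop : ∀ t, IsTopElt m j t → ∀ r : R, ((i t) r).Dom)
    (hisup : ∀ C : Set α, Commuting m j C → IsSupOf pmeet (i '' C) (i (sup C)))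
    (a b : α) (hD : DRel m a b) (hab : a ≠ b) :
    ∃ q : α → P3,
      (∀ x y, q (m x y) = m3 (q x) (q y)) ∧
      (∀ x y, q (j x y) = j3 (q x) (q y)) ∧
      q z = P3.zero ∧
      (∀ t, IsTopElt m j t → q t ≠ P3.zero) ∧
      (∀ C : Set α, Commuting m j C → IsSupOf m3 (q '' C) (q (sup C))) ∧
      q a = P3.ta ∧ q b = P3.tb := by
  have hDi : DRel pmeet (i a) (i b) :=
    ⟨by rw [← him, ← him, hD.1], by rw [← him, ← him, hD.2]⟩
  obtain ⟨r, c, ha, hb⟩ := exists_evalP3_of_DRel hDi (hinj.ne hab)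
  refine ⟨fun x => evalP3 r c (i x), fun x y => ?_, fun x y => ?_, ?_,
    fun t ht h => (evalP3_eq_zero_iff r c (i t)).1 h (hitop t ht r), fun C hC => ?_, ha, hb⟩
  · simp only [him, evalP3_pmeet]
  · simp only [hij, evalP3_pjoin]
  · simp only [hiz]
    exact (evalP3_eq_zero_iff r c pzero).2 id
  · rw [← Set.image_image (evalP3 r c) i C]
    exact isSupOf_evalP3 r c (hisup C hC)
end
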